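/- Let a > 0, b > 0, σ > 0, and let ν be a measure on (0,∞) with ∫_0^∞ (z∧1) ν(dz) < ∞ and ∫_{(1,∞)} log z ν(dz) < ∞. Let (μ_{t,x})_{t≥0, x≥0} be a family of probability measures on [0,∞) such that for all t ≥ 0, x ≥ 0 and all real u ≤ 0, ∫ e^{uy} μ_{t,x}(dy) = (1 − (σ²u/(2b))(1 − e^{−bt}))^{−2a/σ²} · exp(x ψ(t,u)) · exp(∫_0^t ∫_0^∞ (e^{zψ(s,u)} − 1) ν(dz) ds). Then there exists a probability measure π on [0,∞) such that for every x ≥ 0, the total variation distance ‖μ_{t,x} − π‖_TV tends to 0 as t → ∞. (This is the ergodicity of the jump-diffusion CIR process: μ_{t,x} is its transition probability P^t(x,·).) -/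

import Mathlib

open MeasureTheory Filter Set
open scoped ENNReal

/-- `ψ(t,u) = u e^{−bt} / (1 − (σ²u/(2b))(1 − e^{−bt}))`. -/
noncomputable def psi (b σ t u : ℝ) : ℝ :=
  u * Real.exp (-b * t) / (1 - σ ^ 2 * u / (2 * b) * (1 - Real.exp (-b * t)))

/-- The total variation norm `‖μ − π‖_TV` of the difference of two (finite) measures,
expressed via the Jordan decomposition `(μ − π)(univ) + (π − μ)(univ)`
(using truncated subtraction of measures). -/
noncomputable def tvDist (μ π : Measure ℝ) : ℝ≥0∞ :=
  (μ - π) Set.univ + (π - μ) Set.univ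


/-- Laplace transform as a lintegral. -/
noncomputable def lapT (μ : Measure ℝ) (u : ℝ) : ℝ≥0∞ :=
  ∫⁻ y, ENNReal.ofReal (Real.exp (u * y)) ∂μ

lemma lapT_meas (u : ℝ) : Measurable (fun y : ℝ => ENNReal.ofReal (Real.exp (u * y))) := by
  fun_prop

lemma lapT_zero (μ : Measure ℝ) : lapT μ 0 = μ Set.univ := by simp [lapT]

lemma lapT_smul (μ : Measure ℝ) (c : ℝ≥0∞) (u : ℝ) : lapT (c • μ) u = c * lapT μ u := by
  simp [lapT]

lemma lapT_le (μ : Measure ℝ) (hs : μ (Set.Iio 0) = 0) (u : ℝ) (hu : u ≤ 0) :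
    lapT μ u ≤ μ Set.univ := by
  rw [← lapT_zero]
  apply lintegral_mono_ae
  have : ∀ᵐ y ∂μ, ¬ (y < 0) := by
    rw [ae_iff]; simp only [not_not]; exact hs
  filter_upwards [this] with y hy
  apply ENNReal.ofReal_le_ofReal
  apply Real.exp_le_exp.2
  nlinarith

noncomputable def expBCF : BoundedContinuousFunction NNReal ℝ :=
  BoundedContinuousFunction.ofNormedAddCommGroup (fun y : NNReal => Real.exp (-(y : ℝ)))
    (by fun_prop) 1 (by intro y; simp [abs_of_pos (Real.exp_pos _)])

noncomputable def expAlg : StarSubalgebra ℝ (BoundedContinuousFunction NNReal ℝ) :=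
  { Algebra.adjoin ℝ {expBCF} with
    star_mem' := by
      intro x hx
      have : star x = x := by ext y; simp
      rw [this]; exact hx }

lemma lapT_ext (μ ν : Measure ℝ) [IsFiniteMeasure μ] [IsFiniteMeasure ν]
    (hμ : μ (Set.Iio 0) = 0) (hν : ν (Set.Iio 0) = 0)
    (h : ∀ u : ℝ, u ≤ 0 → lapT μ u = lapT ν u) : μ = ν := by
  have key : μ.map Real.toNNReal = ν.map Real.toNNReal := by
    apply ext_of_forall_mem_subalgebra_integral_eq_of_pseudoEMetric_complete_countable
      (𝕜 := ℝ) (A := expAlg)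
    · intro x y hxy
      refine ⟨fun z => Real.exp (-(z : ℝ)), ?_, ?_⟩
      · refine ⟨expBCF.toContinuousMap, ?_, rfl⟩
        exact ⟨expBCF, Algebra.subset_adjoin rfl, rfl⟩
      · intro he
        apply hxy
        have := Real.exp_injective he
        simpa using this
    · intro g hg
      have hg' : g ∈ Algebra.adjoin ℝ {expBCF} := hg
      rw [Algebra.adjoin_singleton_eq_range_aeval] at hg'
      obtain ⟨p, rfl⟩ := hg'
      have hint : ∀ (ρ : Measure ℝ) [IsFiniteMeasure ρ] (g : BoundedContinuousFunction NNReal ℝ),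
        Integrable (fun x => g x) (ρ.map Real.toNNReal) := fun ρ _ g => g.integrable _
      induction p using Polynomial.induction_on' with
      | add p q hp hq =>
        have hp' := hp (by
          show _ ∈ Algebra.adjoin ℝ {expBCF}
          rw [Algebra.adjoin_singleton_eq_range_aeval]; exact ⟨p, rfl⟩)
        have hq' := hq (by
          show _ ∈ Algebra.adjoin ℝ {expBCF}
          rw [Algebra.adjoin_singleton_eq_range_aeval]; exact ⟨q, rfl⟩)
        simp only [map_add, BoundedContinuousFunction.coe_add, Pi.add_apply] at *
        rw [integral_add (hint μ _) (hint μ _), integral_add (hint ν _) (hint ν _), hp', hq']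
      | monomial n a =>
        have e : ∀ x : NNReal, ((Polynomial.aeval expBCF) (Polynomial.monomial n a)) x
            = a * Real.exp (-(n : ℝ) * x) := by
          intro x
          rw [Polynomial.aeval_monomial]
          simp [Algebra.algebraMap_eq_smul_one, expBCF, ← Real.exp_nat_mul]
        have e2 : ∀ (ρ : Measure ℝ), ρ (Set.Iio 0) = 0 →
            ∫ x, Real.exp (-(n : ℝ) * (x : NNReal)) ∂(ρ.map Real.toNNReal) = (lapT ρ (-n)).toReal := by
          intro ρ hρ
          rw [integral_map (by fun_prop) (by fun_prop), integral_eq_lintegral_of_nonneg_ae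
            (Eventually.of_forall fun x => (Real.exp_pos _).le) (by fun_prop), lapT]
          congr 1
          apply lintegral_congr_ae
          have : ∀ᵐ y ∂ρ, ¬ (y < 0) := by
            rw [ae_iff]; simp only [not_not]; exact hρ
          filter_upwards [this] with y hy
          rw [Real.coe_toNNReal _ (not_lt.1 hy)]
        have e3 : ∀ ρ : Measure NNReal, ∫ x, ((Polynomial.aeval expBCF) (Polynomial.monomial n a)) x ∂ρ = ∫ x : NNReal, a * Real.exp (-(n : ℝ) * x) ∂ρ := fun ρ => integral_congr_ae (Eventually.of_forall e)
        erw [e3, e3]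
        rw [integral_const_mul, integral_const_mul, e2 μ hμ, e2 ν hν, h _ (by simp)]
  have back : ∀ ρ : Measure ℝ, ρ (Set.Iio 0) = 0 → (ρ.map Real.toNNReal).map NNReal.toReal = ρ := by
    intro ρ hρ
    rw [Measure.map_map (by fun_prop) (by fun_prop)]
    have : (NNReal.toReal ∘ Real.toNNReal) =ᵐ[ρ] id := by
      have : ∀ᵐ y ∂ρ, ¬ (y < 0) := by
        rw [ae_iff]; simp only [not_not]; exact hρ
      filter_upwards [this] with y hy
      simp [Real.coe_toNNReal _ (not_lt.1 hy)]
    rw [Measure.map_congr this, Measure.map_id]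
  rw [← back μ hμ, ← back ν hν, key]

noncomputable def convPow (μ M : Measure ℝ) : ℕ → Measure ℝ
  | 0 => μ
  | k + 1 => (convPow μ M k).conv M

lemma convPow_finite (μ M : Measure ℝ) [IsFiniteMeasure μ] [IsFiniteMeasure M] (k : ℕ) :
    IsFiniteMeasure (convPow μ M k) := by
  induction k with
  | zero => simpa [convPow]
  | succ k ih => simp only [convPow]; infer_instance

lemma convPow_supp (μ M : Measure ℝ) [IsFiniteMeasure μ] [IsFiniteMeasure M]
    (hμ : μ (Set.Iio 0) = 0) (hM : M (Set.Iio 0) = 0) (k : ℕ) :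
    convPow μ M k (Set.Iio 0) = 0 := by
  induction k with
  | zero => simpa [convPow]
  | succ k ih =>
    have := convPow_finite μ M k
    simp only [convPow]
    rw [← lintegral_indicator_one measurableSet_Iio,
      Measure.lintegral_conv (measurable_one.indicator measurableSet_Iio)]
    have h1 : ∀ᵐ y ∂(convPow μ M k), ¬ (y < 0) := by
      rw [ae_iff]; simp only [not_not]; exact ih
    have h2 : ∀ᵐ y ∂M, ¬ (y < 0) := by
      rw [ae_iff]; simp only [not_not]; exact hM
    rw [lintegral_eq_zero_of_ae_eq_zero]
    filter_upwards [h1] with x hx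
    apply lintegral_eq_zero_of_ae_eq_zero
    filter_upwards [h2] with y hy
    have : ¬ (x + y < 0) := by push Not at *; linarith
    simp [this]

lemma convPow_lapT (μ M : Measure ℝ) [IsFiniteMeasure μ] [IsFiniteMeasure M]
    (u : ℝ) (k : ℕ) :
    lapT (convPow μ M k) u = lapT μ u * lapT M u ^ k := by
  induction k with
  | zero => simp [convPow]
  | succ k ih =>
    have := convPow_finite μ M k
    simp only [convPow]
    rw [lapT, Measure.lintegral_conv (lapT_meas u), pow_succ, ← mul_assoc, ← ih, lapT, lapT,
      ← lintegral_mul_const _ (lapT_meas u)]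
    apply lintegral_congr
    intro x
    rw [← lintegral_const_mul _ (lapT_meas u)]
    apply lintegral_congr
    intro y
    rw [← ENNReal.ofReal_mul (Real.exp_pos _).le, ← Real.exp_add]
    ring_nf

lemma tsum_exp (m : ℝ≥0∞) (hm : m ≠ ⊤) :
    ∑' k : ℕ, ENNReal.ofReal (1 / (k.factorial : ℝ)) * m ^ k = ENNReal.ofReal (Real.exp m.toReal) := by
  obtain ⟨r, rfl⟩ : ∃ r : NNReal, m = r := ⟨m.toNNReal, (ENNReal.coe_toNNReal hm).symm⟩
  rw [Real.exp_eq_exp_ℝ, NormedSpace.exp_eq_tsum_div]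
  simp only []
  rw [ENNReal.ofReal_tsum_of_nonneg]
  · congr 1; ext k
    rw [← ENNReal.ofReal_coe_nnreal, ← ENNReal.ofReal_pow (by positivity),
      ← ENNReal.ofReal_mul (by positivity)]
    congr 1
    simp
    ring
  · intro n; positivity
  · exact NormedSpace.expSeries_div_summable (𝔸 := ℝ) (r : ℝ)

lemma cp_le (μ₁ μ₂ M : Measure ℝ) [IsFiniteMeasure μ₁] [IsFiniteMeasure μ₂] [IsFiniteMeasure M]
    (h1 : μ₁ (Set.Iio 0) = 0) (h2 : μ₂ (Set.Iio 0) = 0) (hM : M (Set.Iio 0) = 0)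
    (h : ∀ u : ℝ, u ≤ 0 → ENNReal.ofReal (Real.exp (M Set.univ).toReal) * lapT μ₂ u =
      lapT μ₁ u * ENNReal.ofReal (Real.exp (lapT M u).toReal)) :
    μ₁ ≤ ENNReal.ofReal (Real.exp (M Set.univ).toReal) • μ₂ := by
  set N : Measure ℝ := Measure.sum (fun k : ℕ =>
    ENNReal.ofReal (1 / (k.factorial : ℝ)) • convPow μ₁ M k) with hN
  have hfin : IsFiniteMeasure (ENNReal.ofReal (Real.exp (M Set.univ).toReal) • μ₂) :=
    Measure.smul_finite _ ENNReal.ofReal_ne_top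
  have hlap : ∀ u : ℝ, u ≤ 0 →
      lapT N u = lapT (ENNReal.ofReal (Real.exp (M Set.univ).toReal) • μ₂) u := by
    intro u hu
    rw [lapT_smul, h u hu, ← tsum_exp, ← ENNReal.tsum_mul_left, lapT, hN, lintegral_sum_measure]
    · congr 1; ext k
      have := convPow_lapT μ₁ M u k
      rw [lintegral_smul_measure, smul_eq_mul]
      rw [lapT] at this
      rw [this]; ring
    · exact ((lapT_le M hM u hu).trans_lt (measure_lt_top _ _)).ne
  have hNfin : IsFiniteMeasure N := by
    constructor
    rw [← lapT_zero, hlap 0 le_rfl, lapT_zero]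
    exact measure_lt_top _ _
  have hNs : N (Set.Iio 0) = 0 := by
    rw [hN, Measure.sum_apply _ measurableSet_Iio]
    simp [convPow_supp μ₁ M h1 hM]
  have : N = ENNReal.ofReal (Real.exp (M Set.univ).toReal) • μ₂ :=
    lapT_ext _ _ hNs (by simp [h2]) hlap
  rw [← this, hN]
  have := Measure.le_sum (fun k : ℕ =>
    ENNReal.ofReal (1 / (k.factorial : ℝ)) • convPow μ₁ M k) 0
  simpa [convPow] using this

noncomputable def ccF (b σ s : ℝ) : ℝ := σ ^ 2 / (2 * b) * (1 - Real.exp (-b * s))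

noncomputable def kapF (b σ s : ℝ) : ℝ := Real.exp (-b * s) / ccF b σ s

section basic
variable {b σ : ℝ} (hb : 0 < b) (hσ : 0 < σ)
include hb hσ

lemma ccF_nonneg {s : ℝ} (hs : 0 ≤ s) : 0 ≤ ccF b σ s := by
  unfold ccF
  have : Real.exp (-b * s) ≤ 1 := Real.exp_le_one_iff.2 (by nlinarith)
  have : 0 ≤ 1 - Real.exp (-b * s) := by linarith
  positivity

lemma ccF_pos {s : ℝ} (hs : 0 < s) : 0 < ccF b σ s := by
  unfold ccF
  have : Real.exp (-b * s) < 1 := by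
    rw [Real.exp_lt_one_iff]; nlinarith
  have : 0 < 1 - Real.exp (-b * s) := by linarith
  positivity

lemma ccF_mono {s t : ℝ} (hs : s ≤ t) : ccF b σ s ≤ ccF b σ t := by
  unfold ccF
  have : Real.exp (-b * t) ≤ Real.exp (-b * s) := Real.exp_le_exp.2 (by nlinarith)
  gcongr

omit hb hσ in
lemma psi_eq (s u : ℝ) : psi b σ s u = u * Real.exp (-b * s) / (1 - ccF b σ s * u) := by
  unfold psi ccF
  congr 1
  ring

lemma den_ge {s u : ℝ} (hs : 0 ≤ s) (hu : u ≤ 0) : 1 ≤ 1 - ccF b σ s * u := by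
  have := ccF_nonneg hb hσ hs
  nlinarith

lemma kapF_pos {s : ℝ} (hs : 0 < s) : 0 < kapF b σ s :=
  div_pos (Real.exp_pos _) (ccF_pos hb hσ hs)

lemma psi_add {s u : ℝ} (hs : 0 < s) (hu : u ≤ 0) :
    psi b σ s u + kapF b σ s = kapF b σ s * (1 / (1 - ccF b σ s * u)) := by
  rw [psi_eq]; unfold kapF
  have h1 := ccF_pos hb hσ hs
  have h2 := den_ge hb hσ hs.le hu
  have h3 : (1 - ccF b σ s * u) ≠ 0 := by linarith
  rw [div_add_div _ _ h3 h1.ne', mul_one_div, div_div, div_eq_div_iff (by positivity) (by positivity)]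
  ring

lemma psi_nonpos {s u : ℝ} (hs : 0 ≤ s) (hu : u ≤ 0) : psi b σ s u ≤ 0 := by
  rw [psi_eq]
  have h2 := den_ge hb hσ hs hu
  apply div_nonpos_of_nonpos_of_nonneg
  · exact mul_nonpos_of_nonpos_of_nonneg hu (Real.exp_pos _).le
  · linarith

lemma psi_ge {s u : ℝ} (hs : 0 ≤ s) (hu : u ≤ 0) : u ≤ psi b σ s u := by
  rw [psi_eq]
  have h2 := den_ge hb hσ hs hu
  rw [le_div_iff₀ (by linarith)]
  have : Real.exp (-b * s) ≤ 1 := Real.exp_le_one_iff.2 (by nlinarith)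
  nlinarith

lemma psi_ge_neg {s u : ℝ} (hs : 0 < s) (hu : u ≤ 0) : 0 ≤ psi b σ s u + kapF b σ s := by
  rw [psi_add hb hσ hs hu]
  have h1 := kapF_pos hb hσ hs
  have h2 := den_ge hb hσ hs.le hu
  have : 0 < 1 - ccF b σ s * u := by linarith
  positivity

end basic

lemma gamma_lap {c : ℝ} (hc : 0 < c) {u : ℝ} (hu : u ≤ 0) (k : ℕ) :
    ∫⁻ y, ProbabilityTheory.gammaPDF ((k : ℝ) + 1) (1 / c) y * ENNReal.ofReal (Real.exp (u * y))
      = ENNReal.ofReal ((1 / (1 - c * u)) ^ (k + 1)) := by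
  have hk : (0 : ℝ) < (k : ℝ) + 1 := by positivity
  have hd : 0 < 1 - c * u := by nlinarith
  have hr : 0 < 1 / c := by positivity
  have hr' : 0 < 1 / c - u := by linarith
  have : ∀ y, ProbabilityTheory.gammaPDF ((k : ℝ) + 1) (1 / c) y * ENNReal.ofReal (Real.exp (u * y))
      = ENNReal.ofReal ((1 / (1 - c * u)) ^ (k + 1)) *
        ProbabilityTheory.gammaPDF ((k : ℝ) + 1) (1 / c - u) y := by
    intro y
    rw [ProbabilityTheory.gammaPDF, ProbabilityTheory.gammaPDF,
      ← ENNReal.ofReal_mul (ProbabilityTheory.gammaPDFReal_nonneg hk hr y),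
      ← ENNReal.ofReal_mul (by positivity)]
    congr 1
    unfold ProbabilityTheory.gammaPDFReal
    split_ifs
    · have e1 : (1 / (1 - c * u)) ^ (k + 1) * (1 / c - u) ^ ((k : ℝ) + 1) = (1 / c) ^ ((k : ℝ) + 1) := by
        rw [← Real.rpow_natCast, Nat.cast_add, Nat.cast_one, ← Real.mul_rpow (by positivity) hr'.le]
        congr 1
        field_simp
      rw [← e1, show -((1 / c - u) * y) = -(1 / c * y) + u * y by ring, Real.exp_add]
      ring
    · simp
  simp_rw [this]
  rw [lintegral_const_mul, ProbabilityTheory.lintegral_gammaPDF_eq_one hk hr', mul_one]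
  unfold ProbabilityTheory.gammaPDF
  fun_prop

noncomputable def densF (b σ s z y : ℝ) : ℝ≥0∞ :=
  ∑' k : ℕ, ENNReal.ofReal (Real.exp (-(z * kapF b σ s)) * (z * kapF b σ s) ^ (k + 1) / (k + 1).factorial) *
    ProbabilityTheory.gammaPDF ((k : ℝ) + 1) (1 / ccF b σ s) y

lemma ccF_meas (b σ : ℝ) : Measurable (ccF b σ) := by
  unfold ccF; fun_prop

lemma kapF_meas (b σ : ℝ) : Measurable (kapF b σ) := by
  have := ccF_meas b σ
  unfold kapF; fun_prop

lemma psi_meas (b σ u : ℝ) : Measurable (fun s => psi b σ s u) := by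
  unfold psi; fun_prop

lemma gammaPDF_meas (b σ a : ℝ) :
    Measurable (fun p : ℝ × ℝ => ProbabilityTheory.gammaPDF a (1 / ccF b σ p.1) p.2) := by
  have := ccF_meas b σ
  unfold ProbabilityTheory.gammaPDF ProbabilityTheory.gammaPDFReal
  apply Measurable.ennreal_ofReal
  apply Measurable.ite
  · exact measurableSet_le measurable_const measurable_snd
  · fun_prop
  · fun_prop

lemma densF_meas (b σ : ℝ) :
    Measurable (fun p : (ℝ × ℝ) × ℝ => densF b σ p.1.1 p.2 p.1.2) := by
  unfold densF
  have h1 := kapF_meas b σ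
  apply Measurable.tsum
  intro k
  apply Measurable.fun_mul
  · fun_prop
  · exact (gammaPDF_meas b σ _).comp measurable_fst

lemma densF_lap {b σ : ℝ} (hb : 0 < b) (hσ : 0 < σ) {s u z : ℝ} (hs : 0 < s) (hu : u ≤ 0) (hz : 0 ≤ z) :
    ∫⁻ y, densF b σ s z y * ENNReal.ofReal (Real.exp (u * y)) =
      ENNReal.ofReal (Real.exp (z * psi b σ s u) - Real.exp (-(z * kapF b σ s))) := by
  have hk := kapF_pos hb hσ hs
  have hc := ccF_pos hb hσ hs
  have hd := den_ge hb hσ hs.le hu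
  have hd' : 0 < 1 - ccF b σ s * u := by linarith
  unfold densF
  simp_rw [← ENNReal.tsum_mul_right, mul_assoc]
  rw [lintegral_tsum]
  · have : ∀ k : ℕ, ∫⁻ y, ENNReal.ofReal (Real.exp (-(z * kapF b σ s)) * (z * kapF b σ s) ^ (k + 1) / (k + 1).factorial) *
      (ProbabilityTheory.gammaPDF ((k : ℝ) + 1) (1 / ccF b σ s) y * ENNReal.ofReal (Real.exp (u * y)))
      = ENNReal.ofReal (Real.exp (-(z * kapF b σ s)) * ((z * (psi b σ s u + kapF b σ s)) ^ (k + 1) / (k + 1).factorial)) := by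
      intro k
      rw [lintegral_const_mul, gamma_lap hc hu, ← ENNReal.ofReal_mul (by positivity), psi_add hb hσ hs hu]
      · congr 1
        simp only [mul_pow]
        ring
      · have := ProbabilityTheory.measurable_gammaPDFReal ((k : ℝ) + 1) (1 / ccF b σ s)
        unfold ProbabilityTheory.gammaPDF
        fun_prop
    simp_rw [← mul_assoc] at this ⊢
    simp_rw [this]
    have hnn := psi_ge_neg hb hσ hs hu
    have hsum := NormedSpace.expSeries_div_summable (𝔸 := ℝ) (z * (psi b σ s u + kapF b σ s))
    rw [← ENNReal.ofReal_tsum_of_nonneg]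
    · congr 1
      rw [tsum_mul_left]
      have h0 := hsum.tsum_eq_zero_add
      have he : Real.exp (z * (psi b σ s u + kapF b σ s)) = ∑' n : ℕ, (z * (psi b σ s u + kapF b σ s)) ^ n / (n.factorial : ℝ) := by
        rw [Real.exp_eq_exp_ℝ, NormedSpace.exp_eq_tsum_div]
      rw [← he] at h0
      have : ∑' (k : ℕ), (z * (psi b σ s u + kapF b σ s)) ^ (k + 1) / ((k + 1).factorial : ℝ) =
          Real.exp (z * (psi b σ s u + kapF b σ s)) - 1 := by
        rw [h0]; simp
      rw [this, mul_sub, ← Real.exp_add]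
      ring_nf
    · intro n; positivity
    · apply Summable.mul_left
      exact (summable_nat_add_iff 1).2 hsum
  · intro k
    have := ProbabilityTheory.measurable_gammaPDFReal ((k : ℝ) + 1) (1 / ccF b σ s)
    unfold ProbabilityTheory.gammaPDF
    fun_prop

noncomputable def DF (a b σ : ℝ) (ρ : Measure ℝ) (s y : ℝ) : ℝ≥0∞ :=
  ENNReal.ofReal (a * kapF b σ s) * ProbabilityTheory.gammaPDF (((0 : ℕ) : ℝ) + 1) (1 / ccF b σ s) y
    + ∫⁻ z, densF b σ s z y ∂ρ

noncomputable def pF (a b σ : ℝ) (ρ : Measure ℝ) (s u : ℝ) : ℝ≥0∞ :=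
  ENNReal.ofReal (a * (psi b σ s u + kapF b σ s)) +
    ∫⁻ z, ENNReal.ofReal (Real.exp (z * psi b σ s u) - Real.exp (-(z * kapF b σ s))) ∂ρ

noncomputable def phiF (a b σ : ℝ) (ρ : Measure ℝ) (s u : ℝ) : ℝ≥0∞ :=
  ENNReal.ofReal (-(a * psi b σ s u)) + ∫⁻ z, ENNReal.ofReal (1 - Real.exp (z * psi b σ s u)) ∂ρ

lemma DF_meas (a b σ : ℝ) (ρ : Measure ℝ) [SFinite ρ] :
    Measurable (fun p : ℝ × ℝ => DF a b σ ρ p.1 p.2) := by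
  unfold DF
  have h1 := kapF_meas b σ
  apply Measurable.fun_add
  · apply Measurable.fun_mul
    · fun_prop
    · exact gammaPDF_meas b σ _
  · exact (densF_meas b σ).lintegral_prod_right'

lemma DF_lap {a b σ : ℝ} (ha : 0 < a) (hb : 0 < b) (hσ : 0 < σ) (ρ : Measure ℝ) [SFinite ρ]
    (hρ : ∀ᵐ z ∂ρ, 0 < z) {s u : ℝ} (hs : 0 < s) (hu : u ≤ 0) :
    ∫⁻ y, DF a b σ ρ s y * ENNReal.ofReal (Real.exp (u * y)) = pF a b σ ρ s u := by
  unfold DF pF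
  have hk := kapF_pos hb hσ hs
  have hc := ccF_pos hb hσ hs
  have hm := (gammaPDF_meas b σ (((0 : ℕ) : ℝ) + 1)).comp (measurable_prodMk_left (x := s))
  simp only [Function.comp_def] at hm
  have hm1 : Measurable (fun p : ℝ × ℝ => ((s, p.1), p.2)) := by fun_prop
  have hm2 := (densF_meas b σ).comp hm1
  simp only [Function.comp_def] at hm2
  have hm3 : Measurable (fun p : ℝ × ℝ => densF b σ s p.2 p.1 * ENNReal.ofReal (Real.exp (u * p.1))) :=
    hm2.fun_mul (by fun_prop)
  simp_rw [add_mul]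
  rw [lintegral_add_left (by fun_prop)]
  congr 1
  · simp_rw [mul_assoc]
    rw [lintegral_const_mul _ (by fun_prop), gamma_lap hc hu, ← ENNReal.ofReal_mul (by positivity),
      psi_add hb hσ hs hu]
    congr 1
    ring
  · have : ∀ y, (∫⁻ z, densF b σ s z y ∂ρ) * ENNReal.ofReal (Real.exp (u * y)) =
      ∫⁻ z, densF b σ s z y * ENNReal.ofReal (Real.exp (u * y)) ∂ρ := by
      intro y
      have h5 := hm2.comp (measurable_prodMk_left (x := y))
      simp only [Function.comp_def] at h5
      exact (lintegral_mul_const _ h5).symm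
    rw [lintegral_congr this]
    rw [lintegral_lintegral_swap]
    · apply lintegral_congr_ae
      filter_upwards [hρ] with z hz
      exact densF_lap hb hσ hs hu hz.le
    · exact hm3.aemeasurable

lemma DF_neg (a b σ : ℝ) (ρ : Measure ℝ) (s : ℝ) {y : ℝ} (hy : y < 0) : DF a b σ ρ s y = 0 := by
  unfold DF densF
  simp [ProbabilityTheory.gammaPDF_of_neg hy]

noncomputable def MF (a b σ : ℝ) (ρ : Measure ℝ) (T t : ℝ) : Measure ℝ :=
  (volume : Measure ℝ).withDensity (fun y => ∫⁻ s in Set.Ioc T t, DF a b σ ρ s y)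

lemma MF_supp (a b σ : ℝ) (ρ : Measure ℝ) (T t : ℝ) : MF a b σ ρ T t (Set.Iio 0) = 0 := by
  unfold MF
  rw [withDensity_apply _ measurableSet_Iio]
  rw [setLIntegral_congr_fun (g := fun _ => 0) measurableSet_Iio]
  · simp
  · intro y hy
    simp only [DF_neg a b σ ρ _ hy, lintegral_zero]

lemma MF_lap {a b σ : ℝ} (ha : 0 < a) (hb : 0 < b) (hσ : 0 < σ) (ρ : Measure ℝ) [SFinite ρ]
    (hρ : ∀ᵐ z ∂ρ, 0 < z) {T t u : ℝ} (hT : 0 < T) (hu : u ≤ 0) :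
    lapT (MF a b σ ρ T t) u = ∫⁻ s in Set.Ioc T t, pF a b σ ρ s u := by
  unfold lapT MF
  have hm := DF_meas a b σ ρ
  have hm' := hm.comp measurable_swap
  simp only [Function.comp_def, Prod.fst_swap, Prod.snd_swap] at hm'
  have hm3 : Measurable (fun p : ℝ × ℝ => DF a b σ ρ p.2 p.1 * ENNReal.ofReal (Real.exp (u * p.1))) :=
    hm'.fun_mul (by fun_prop)
  rw [lintegral_withDensity_eq_lintegral_mul _ _ (lapT_meas u)]
  · simp only [Pi.mul_apply]
    have : ∀ y, (∫⁻ s in Set.Ioc T t, DF a b σ ρ s y) * ENNReal.ofReal (Real.exp (u * y)) =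
      ∫⁻ s in Set.Ioc T t, DF a b σ ρ s y * ENNReal.ofReal (Real.exp (u * y)) := by
      intro y
      have h5 := hm'.comp (measurable_prodMk_left (x := y))
      simp only [Function.comp_def] at h5
      exact (lintegral_mul_const _ h5).symm
    rw [lintegral_congr this]
    rw [lintegral_lintegral_swap]
    · apply setLIntegral_congr_fun measurableSet_Ioc
      intro s hs
      exact DF_lap ha hb hσ ρ hρ (hT.trans hs.1) hu
    · exact hm3.aemeasurable
  · exact hm'.lintegral_prod_right'

lemma pF_add_phiF {a b σ : ℝ} (ha : 0 < a) (hb : 0 < b) (hσ : 0 < σ) (ρ : Measure ℝ) [SFinite ρ]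
    (hρ : ∀ᵐ z ∂ρ, 0 < z) {s u : ℝ} (hs : 0 < s) (hu : u ≤ 0) :
    pF a b σ ρ s u + phiF a b σ ρ s u = pF a b σ ρ s 0 := by
  unfold pF phiF
  have h1 := psi_ge_neg hb hσ hs hu
  have h2 := psi_nonpos hb hσ hs.le hu
  have h0 : psi b σ s 0 = 0 := by simp [psi]
  rw [add_add_add_comm]
  congr 1
  · rw [← ENNReal.ofReal_add (by positivity) (by nlinarith), h0]
    congr 1; ring
  · rw [← lintegral_add_left (by fun_prop)]
    apply lintegral_congr_ae
    filter_upwards [hρ] with z hz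
    rw [← ENNReal.ofReal_add, h0]
    · congr 1; simp
    · have : -(z * kapF b σ s) ≤ z * psi b σ s u := by nlinarith
      have := Real.exp_le_exp.2 this
      linarith
    · have : z * psi b σ s u ≤ 0 := by nlinarith
      have := Real.exp_le_one_iff.2 this
      linarith

lemma phiF_meas (a b σ : ℝ) (ρ : Measure ℝ) [SFinite ρ] (u : ℝ) :
    Measurable (fun s => phiF a b σ ρ s u) := by
  unfold phiF
  have h := psi_meas b σ u
  apply Measurable.fun_add
  · fun_prop
  · apply Measurable.lintegral_prod_right' (f := fun p : ℝ × ℝ => ENNReal.ofReal (1 - Real.exp (p.2 * psi b σ p.1 u)))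
    fun_prop

lemma pF_meas (a b σ : ℝ) (ρ : Measure ℝ) [SFinite ρ] (u : ℝ) :
    Measurable (fun s => pF a b σ ρ s u) := by
  unfold pF
  have h := psi_meas b σ u
  have h' := kapF_meas b σ
  apply Measurable.fun_add
  · fun_prop
  · apply Measurable.lintegral_prod_right' (f := fun p : ℝ × ℝ => ENNReal.ofReal (Real.exp (p.2 * psi b σ p.1 u) - Real.exp (-(p.2 * kapF b σ p.1))))
    fun_prop

noncomputable def JF (b σ : ℝ) (ρ : Measure ℝ) (s u : ℝ) : ℝ≥0∞ :=
  ∫⁻ z, ENNReal.ofReal (1 - Real.exp (z * psi b σ s u)) ∂ρ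

lemma JF_meas (b σ : ℝ) (ρ : Measure ℝ) [SFinite ρ] (u : ℝ) :
    Measurable (fun s => JF b σ ρ s u) := by
  unfold JF
  have h := psi_meas b σ u
  apply Measurable.lintegral_prod_right' (f := fun p : ℝ × ℝ => ENNReal.ofReal (1 - Real.exp (p.2 * psi b σ p.1 u)))
  fun_prop

lemma JF_le {b σ : ℝ} (hb : 0 < b) (hσ : 0 < σ) (ρ : Measure ℝ)
    (hρ : ∀ᵐ z ∂ρ, 0 < z) {s u : ℝ} (hs : 0 ≤ s) (hu : u ≤ 0) :
    JF b σ ρ s u ≤ ENNReal.ofReal (1 - u) * ∫⁻ z, ENNReal.ofReal (min z 1) ∂ρ := by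
  unfold JF
  rw [← lintegral_const_mul _ (by fun_prop)]
  apply lintegral_mono_ae
  filter_upwards [hρ] with z hz
  rw [← ENNReal.ofReal_mul (by linarith)]
  apply ENNReal.ofReal_le_ofReal
  have h1 := psi_ge hb hσ hs hu
  have h3 := Real.add_one_le_exp (z * psi b σ s u)
  have h4 := Real.exp_pos (z * psi b σ s u)
  rcases le_total z 1 with h | h
  · rw [min_eq_left h]; nlinarith
  · rw [min_eq_right h]; nlinarith

lemma setJF_lt {b σ : ℝ} (hb : 0 < b) (hσ : 0 < σ) (ρ : Measure ℝ)
    (hρ : ∀ᵐ z ∂ρ, 0 < z) (hfin : ∫⁻ z, ENNReal.ofReal (min z 1) ∂ρ < ⊤) {t u : ℝ} (hu : u ≤ 0) :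
    ∫⁻ s in Set.Ioc 0 t, JF b σ ρ s u < ⊤ := by
  calc ∫⁻ s in Set.Ioc 0 t, JF b σ ρ s u
      ≤ ∫⁻ s in Set.Ioc 0 t, ENNReal.ofReal (1 - u) * ∫⁻ z, ENNReal.ofReal (min z 1) ∂ρ := by
        apply setLIntegral_mono' measurableSet_Ioc
        intro s hs
        exact JF_le hb hσ ρ hρ hs.1.le hu
    _ < ⊤ := by
        rw [setLIntegral_const]
        exact ENNReal.mul_lt_top (ENNReal.mul_lt_top ENNReal.ofReal_lt_top hfin) (by simp)

lemma jump_part {b σ : ℝ} (hb : 0 < b) (hσ : 0 < σ) (ρ : Measure ℝ) [SFinite ρ]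
    (hρ : ∀ᵐ z ∂ρ, 0 < z) (hfin : ∫⁻ z, ENNReal.ofReal (min z 1) ∂ρ < ⊤) {t u : ℝ} (hu : u ≤ 0) :
    ∫ s in Set.Ioc (0 : ℝ) t, ∫ z, (Real.exp (z * psi b σ s u) - 1) ∂ρ =
      -(∫⁻ s in Set.Ioc 0 t, JF b σ ρ s u).toReal := by
  have h1 : ∀ s ∈ Set.Ioc (0 : ℝ) t, ∫ z, (Real.exp (z * psi b σ s u) - 1) ∂ρ =
      -(JF b σ ρ s u).toReal := by
    intro s hs
    have : ∫ z, (Real.exp (z * psi b σ s u) - 1) ∂ρ = - ∫ z, (1 - Real.exp (z * psi b σ s u)) ∂ρ := by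
      rw [← integral_neg]; congr 1; ext z; ring
    rw [this, integral_eq_lintegral_of_nonneg_ae, JF]
    · filter_upwards [hρ] with z hz
      have := psi_nonpos hb hσ hs.1.le hu
      have : Real.exp (z * psi b σ s u) ≤ 1 := Real.exp_le_one_iff.2 (by nlinarith)
      simp only [Pi.zero_apply]; linarith
    · fun_prop
  rw [setIntegral_congr_fun measurableSet_Ioc h1, integral_neg, integral_toReal]
  · exact (JF_meas b σ ρ u).aemeasurable
  · rw [ae_restrict_iff' measurableSet_Ioc]
    refine Eventually.of_forall fun s hs => ?_
    exact (JF_le hb hσ ρ hρ hs.1.le hu).trans_lt (ENNReal.mul_lt_top ENNReal.ofReal_lt_top hfin)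

lemma drift_part {a b σ : ℝ} (ha : 0 < a) (hb : 0 < b) (hσ : 0 < σ) {t u : ℝ} (ht : 0 ≤ t) (hu : u ≤ 0) :
    ∫⁻ s in Set.Ioc (0 : ℝ) t, ENNReal.ofReal (-(a * psi b σ s u)) =
      ENNReal.ofReal (2 * a / σ ^ 2 * Real.log (1 - ccF b σ t * u)) := by
  have hcont : ContinuousOn (fun s => -(a * psi b σ s u)) (Set.uIcc 0 t) := by
    rw [Set.uIcc_of_le ht]
    simp_rw [psi_eq]
    apply ContinuousOn.neg
    apply ContinuousOn.mul continuousOn_const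
    apply ContinuousOn.div (by fun_prop)
    · unfold ccF; fun_prop
    · intro s hs
      have := den_ge hb hσ hs.1 hu
      linarith
  have hderiv : ∀ s ∈ Set.uIcc 0 t, HasDerivAt (fun s => 2 * a / σ ^ 2 * Real.log (1 - ccF b σ s * u))
      (-(a * psi b σ s u)) s := by
    intro s hs
    rw [Set.uIcc_of_le ht] at hs
    have hd := den_ge hb hσ hs.1 hu
    have h1 : HasDerivAt (fun s => Real.exp (-b * s)) (Real.exp (-b * s) * (-b)) s := by
      have := ((hasDerivAt_id s).const_mul (-b)).exp
      simpa using this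
    have h2 : HasDerivAt (fun s => 1 - ccF b σ s * u)
      (-(σ ^ 2 / (2 * b) * (-(Real.exp (-b * s) * (-b))) * u)) s := by
      unfold ccF
      exact (((h1.const_sub 1).const_mul _).mul_const u).const_sub 1
    have h3 := (h2.log (by linarith)).const_mul (2 * a / σ ^ 2)
    refine h3.congr_deriv ?_
    rw [psi_eq]
    have : 1 - ccF b σ s * u ≠ 0 := by linarith
    generalize 1 - ccF b σ s * u = d at *
    field_simp
  have hI := intervalIntegral.integral_eq_sub_of_hasDerivAt hderiv hcont.intervalIntegrable
  rw [intervalIntegral.integral_of_le ht] at hI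
  rw [← ofReal_integral_eq_lintegral_ofReal, hI]
  · simp [ccF]
  · exact (intervalIntegrable_iff_integrableOn_Ioc_of_le ht).1 hcont.intervalIntegrable
  · rw [EventuallyLE, ae_restrict_iff' measurableSet_Ioc]
    refine Eventually.of_forall fun s hs => ?_
    have := psi_nonpos hb hσ hs.1.le hu
    simp only [Pi.zero_apply]; nlinarith

lemma phi_lt {a b σ : ℝ} (ha : 0 < a) (hb : 0 < b) (hσ : 0 < σ) (ρ : Measure ℝ) [SFinite ρ]
    (hρ : ∀ᵐ z ∂ρ, 0 < z) (hfin : ∫⁻ z, ENNReal.ofReal (min z 1) ∂ρ < ⊤) {t u : ℝ} (ht : 0 ≤ t) (hu : u ≤ 0) :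
    ∫⁻ s in Set.Ioc 0 t, phiF a b σ ρ s u < ⊤ := by
  have hm := psi_meas b σ u
  unfold phiF
  rw [lintegral_add_left (by fun_prop), drift_part ha hb hσ ht hu]
  exact ENNReal.add_lt_top.2 ⟨ENNReal.ofReal_lt_top, setJF_lt hb hσ ρ hρ hfin hu⟩

lemma lap_rhs {a b σ : ℝ} (ha : 0 < a) (hb : 0 < b) (hσ : 0 < σ) (ρ : Measure ℝ) [SFinite ρ]
    (hρ : ∀ᵐ z ∂ρ, 0 < z) (hfin : ∫⁻ z, ENNReal.ofReal (min z 1) ∂ρ < ⊤) {t u : ℝ} (x : ℝ) (ht : 0 ≤ t) (hu : u ≤ 0) :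
    (1 - σ ^ 2 * u / (2 * b) * (1 - Real.exp (-b * t))) ^ (-(2 * a / σ ^ 2)) *
          Real.exp (x * psi b σ t u) *
          Real.exp (∫ s in Set.Ioc (0 : ℝ) t, ∫ z, (Real.exp (z * psi b σ s u) - 1) ∂ρ) =
    Real.exp (x * psi b σ t u) * Real.exp (-(∫⁻ s in Set.Ioc 0 t, phiF a b σ ρ s u).toReal) := by
  have hm := psi_meas b σ u
  have e1 : 1 - σ ^ 2 * u / (2 * b) * (1 - Real.exp (-b * t)) = 1 - ccF b σ t * u := by
    unfold ccF; ring
  have hd := den_ge hb hσ ht hu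
  unfold phiF
  rw [lintegral_add_left (by fun_prop), drift_part ha hb hσ ht hu, jump_part hb hσ ρ hρ hfin hu,
    e1, Real.rpow_def_of_pos (by linarith)]
  have hJ := setJF_lt (t := t) hb hσ ρ hρ hfin hu
  unfold JF at hJ ⊢
  rw [ENNReal.toReal_add ENNReal.ofReal_ne_top hJ.ne, ENNReal.toReal_ofReal]
  · rw [mul_comm (Real.exp _) (Real.exp (x * _)), mul_assoc, ← Real.exp_add]
    congr 2
    ring
  · have := Real.log_nonneg hd
    positivity

lemma lap_val {a b σ : ℝ} (ha : 0 < a) (hb : 0 < b) (hσ : 0 < σ) (ρ : Measure ℝ) [SFinite ρ]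
    (hρ : ∀ᵐ z ∂ρ, 0 < z) (hfin : ∫⁻ z, ENNReal.ofReal (min z 1) ∂ρ < ⊤)
    (m : Measure ℝ) [IsProbabilityMeasure m] (hs : m (Set.Iio 0) = 0)
    {t u : ℝ} (x : ℝ) (ht : 0 ≤ t) (hu : u ≤ 0)
    (hL : ∫ y, Real.exp (u * y) ∂m =
        (1 - σ ^ 2 * u / (2 * b) * (1 - Real.exp (-b * t))) ^ (-(2 * a / σ ^ 2)) *
          Real.exp (x * psi b σ t u) *
          Real.exp (∫ s in Set.Ioc (0 : ℝ) t, ∫ z, (Real.exp (z * psi b σ s u) - 1) ∂ρ)) :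
    lapT m u = ENNReal.ofReal (Real.exp (x * psi b σ t u) *
      Real.exp (-(∫⁻ s in Set.Ioc 0 t, phiF a b σ ρ s u).toReal)) := by
  rw [← lap_rhs ha hb hσ ρ hρ hfin x ht hu, ← hL, integral_eq_lintegral_of_nonneg_ae
    (Eventually.of_forall fun y => (Real.exp_pos _).le) (by fun_prop), ENNReal.ofReal_toReal]
  · rfl
  · exact ((lapT_le m hs u hu).trans_lt (measure_lt_top _ _)).ne

lemma step_time {a b σ : ℝ} (ha : 0 < a) (hb : 0 < b) (hσ : 0 < σ) (ρ : Measure ℝ) [SFinite ρ]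
    (hρ : ∀ᵐ z ∂ρ, 0 < z) (hfin : ∫⁻ z, ENNReal.ofReal (min z 1) ∂ρ < ⊤)
    (m₁ m₂ : Measure ℝ) [IsProbabilityMeasure m₁] [IsProbabilityMeasure m₂]
    (hs1 : m₁ (Set.Iio 0) = 0) (hs2 : m₂ (Set.Iio 0) = 0)
    {T t : ℝ} (hT : 0 < T) (hTt : T ≤ t)
    (h1 : ∀ u, u ≤ 0 → lapT m₁ u = ENNReal.ofReal (
      Real.exp (-(∫⁻ s in Set.Ioc 0 T, phiF a b σ ρ s u).toReal)))
    (h2 : ∀ u, u ≤ 0 → lapT m₂ u = ENNReal.ofReal (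
      Real.exp (-(∫⁻ s in Set.Ioc 0 t, phiF a b σ ρ s u).toReal)))
    (hR : ∫⁻ s in Set.Ioc T t, pF a b σ ρ s 0 < ⊤) :
    m₁ ≤ ENNReal.ofReal (Real.exp (∫⁻ s in Set.Ioc T t, pF a b σ ρ s 0).toReal) • m₂ := by
  have hM0 : MF a b σ ρ T t Set.univ = ∫⁻ s in Set.Ioc T t, pF a b σ ρ s 0 := by
    rw [← lapT_zero, MF_lap ha hb hσ ρ hρ hT le_rfl]
  have : IsFiniteMeasure (MF a b σ ρ T t) := ⟨by rw [hM0]; exact hR⟩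
  rw [← hM0]
  apply cp_le _ _ _ hs1 hs2 (MF_supp a b σ ρ T t)
  intro u hu
  rw [h1 u hu, h2 u hu, hM0, MF_lap ha hb hσ ρ hρ hT hu, ← ENNReal.ofReal_mul (Real.exp_pos _).le,
    ← ENNReal.ofReal_mul (Real.exp_pos _).le, ← Real.exp_add, ← Real.exp_add]
  congr 2
  have hsplit : ∫⁻ s in Set.Ioc 0 t, phiF a b σ ρ s u =
      (∫⁻ s in Set.Ioc 0 T, phiF a b σ ρ s u) + ∫⁻ s in Set.Ioc T t, phiF a b σ ρ s u := by
    rw [← Set.Ioc_union_Ioc_eq_Ioc hT.le hTt, lintegral_union measurableSet_Ioc]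
    rw [Set.disjoint_left]
    intro y hy hy'
    exact absurd hy.2 (not_le.2 hy'.1)
  have hf := phi_lt (t := t) ha hb hσ ρ hρ hfin (hT.le.trans hTt) hu
  rw [hsplit] at hf ⊢
  have hf' := ENNReal.add_lt_top.1 hf
  have hadd : ∫⁻ s in Set.Ioc T t, pF a b σ ρ s 0 =
      (∫⁻ s in Set.Ioc T t, pF a b σ ρ s u) + ∫⁻ s in Set.Ioc T t, phiF a b σ ρ s u := by
    rw [← lintegral_add_left (pF_meas a b σ ρ u)]
    apply setLIntegral_congr_fun measurableSet_Ioc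
    intro s hs
    exact (pF_add_phiF ha hb hσ ρ hρ (hT.trans hs.1) hu).symm
  rw [hadd] at hR ⊢
  have hR' := ENNReal.add_lt_top.1 hR
  rw [ENNReal.toReal_add hf'.1.ne hf'.2.ne, ENNReal.toReal_add hR'.1.ne hR'.2.ne]
  ring

lemma step_x {b σ : ℝ} (hb : 0 < b) (hσ : 0 < σ) 
    (m₁ m₂ : Measure ℝ) [IsProbabilityMeasure m₁] [IsProbabilityMeasure m₂]
    (hs1 : m₁ (Set.Iio 0) = 0) (hs2 : m₂ (Set.Iio 0) = 0)
    {t x : ℝ} (ht : 0 < t) (hx : 0 ≤ x)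
    (h : ∀ u, u ≤ 0 → lapT m₂ u = ENNReal.ofReal (Real.exp (x * psi b σ t u)) * lapT m₁ u) :
    m₁ ≤ ENNReal.ofReal (Real.exp (x * kapF b σ t)) • m₂ := by
  have hk := kapF_pos hb hσ ht
  have hc := ccF_pos hb hσ ht
  have hr : 0 < 1 / ccF b σ t := by positivity
  set E := ProbabilityTheory.gammaMeasure (((0 : ℕ) : ℝ) + 1) (1 / ccF b σ t) with hE
  have : IsProbabilityMeasure E := ProbabilityTheory.isProbabilityMeasure_gammaMeasure (by simp) hr
  have hfin : IsFiniteMeasure (ENNReal.ofReal (x * kapF b σ t) • E) :=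
    Measure.smul_finite _ ENNReal.ofReal_ne_top
  have hm := (gammaPDF_meas b σ (((0 : ℕ) : ℝ) + 1)).comp (measurable_prodMk_left (x := t))
  simp only [Function.comp_def] at hm
  have hlap : ∀ u, u ≤ 0 → lapT (ENNReal.ofReal (x * kapF b σ t) • E) u =
      ENNReal.ofReal (x * (psi b σ t u + kapF b σ t)) := by
    intro u hu
    rw [lapT_smul, lapT, hE, ProbabilityTheory.gammaMeasure,
      lintegral_withDensity_eq_lintegral_mul _ hm (lapT_meas u)]
    simp only [Pi.mul_apply]
    rw [gamma_lap hc hu, ← ENNReal.ofReal_mul (by positivity), psi_add hb hσ ht hu]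
    congr 1; ring
  have h0 : (ENNReal.ofReal (x * kapF b σ t) • E) Set.univ = ENNReal.ofReal (x * kapF b σ t) := by
    simp
  have key := cp_le m₁ m₂ (ENNReal.ofReal (x * kapF b σ t) • E) hs1 hs2 ?_ ?_
  · rw [h0, ENNReal.toReal_ofReal (by positivity)] at key
    exact key
  · rw [Measure.smul_apply, hE, ProbabilityTheory.gammaMeasure, withDensity_apply _ measurableSet_Iio,
      ProbabilityTheory.lintegral_gammaPDF_of_nonpos le_rfl, smul_zero]
  · intro u hu
    have h1 := psi_ge_neg hb hσ ht hu
    rw [h u hu, h0, hlap u hu, ENNReal.toReal_ofReal (by positivity), ENNReal.toReal_ofReal (by positivity),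
      ← mul_assoc, ← ENNReal.ofReal_mul (Real.exp_pos _).le, ← Real.exp_add, mul_comm]
    congr 3
    ring

lemma lint_exp {b : ℝ} (hb : 0 < b) (K L : ℝ) (hK : 0 ≤ K) :
    ∫⁻ s in Set.Ioi L, ENNReal.ofReal (K * Real.exp (-b * s)) =
      ENNReal.ofReal (K * (Real.exp (-b * L) / b)) := by
  have hi : IntegrableOn (fun s => K * Real.exp (-b * s)) (Set.Ioi L) :=
    (integrableOn_exp_mul_Ioi (by linarith) L).const_mul K
  rw [← ofReal_integral_eq_lintegral_ofReal hi
    (Eventually.of_forall fun s => mul_nonneg hK (Real.exp_pos _).le), integral_const_mul,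
    integral_exp_mul_Ioi (by linarith)]
  congr 2
  field_simp

lemma kapF_le {b σ : ℝ} (hb : 0 < b) (hσ : 0 < σ) {s : ℝ} (hs : 1 ≤ s) :
    kapF b σ s ≤ 1 / ccF b σ 1 * Real.exp (-b * s) := by
  have h1 := ccF_pos hb hσ one_pos
  have h2 := ccF_mono hb hσ hs
  unfold kapF
  rw [one_div, inv_mul_eq_div]
  gcongr

lemma inner_bound {b : ℝ} (hb : 0 < b) {C z : ℝ} (hC : 0 < C) (hz : 0 < z) :
    ∫⁻ s in Set.Ioi (1 : ℝ), ENNReal.ofReal (1 - Real.exp (-(z * (C * Real.exp (-b * s))))) ≤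
      ENNReal.ofReal (1 / b) * ENNReal.ofReal (max (Real.log z) 0) +
        ENNReal.ofReal (C / b) * ENNReal.ofReal (min z 1) := by
  set L := max (Real.log z) 0 / b with hL
  have hL0 : 0 ≤ L := by positivity
  have hsub : Set.Ioi (1 : ℝ) ⊆ Set.Ioc 0 L ∪ Set.Ioi L := by
    intro s hs
    rcases le_or_gt s L with h | h
    · exact Or.inl ⟨lt_trans one_pos hs, h⟩
    · exact Or.inr h
  refine (lintegral_mono_set hsub).trans ((lintegral_union_le _ _ _).trans ?_)
  apply add_le_add
  · calc ∫⁻ s in Set.Ioc 0 L, ENNReal.ofReal (1 - Real.exp (-(z * (C * Real.exp (-b * s)))))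
        ≤ ∫⁻ s in Set.Ioc 0 L, 1 := by
          apply lintegral_mono
          intro s
          simp only [ENNReal.ofReal_le_one]
          linarith [Real.exp_pos (-(z * (C * Real.exp (-b * s))))]
      _ = ENNReal.ofReal (1 / b) * ENNReal.ofReal (max (Real.log z) 0) := by
          rw [setLIntegral_one, Real.volume_Ioc, ← ENNReal.ofReal_mul (by positivity), hL]
          congr 1; ring
  · calc ∫⁻ s in Set.Ioi L, ENNReal.ofReal (1 - Real.exp (-(z * (C * Real.exp (-b * s)))))
        ≤ ∫⁻ s in Set.Ioi L, ENNReal.ofReal ((z * C) * Real.exp (-b * s)) := by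
          apply lintegral_mono
          intro s
          apply ENNReal.ofReal_le_ofReal
          have := Real.add_one_le_exp (-(z * (C * Real.exp (-b * s))))
          linarith
      _ = ENNReal.ofReal (C / b) * ENNReal.ofReal (min z 1) := by
          rw [lint_exp hb _ _ (by positivity), ← ENNReal.ofReal_mul (by positivity)]
          congr 1
          have : z * Real.exp (-b * L) = min z 1 := by
            rw [hL, show -b * (max (Real.log z) 0 / b) = - max (Real.log z) 0 by field_simp]
            rcases le_total z 1 with h | h
            · rw [max_eq_right (Real.log_nonpos hz.le h), min_eq_left h]; simp
            · rw [max_eq_left (Real.log_nonneg h), min_eq_right h, Real.exp_neg, Real.exp_log hz]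
              field_simp
          rw [← this]; ring

lemma rate_fin {a b σ : ℝ} (ha : 0 < a) (hb : 0 < b) (hσ : 0 < σ) (ρ : Measure ℝ) [SFinite ρ]
    (hρ : ∀ᵐ z ∂ρ, 0 < z) (hfin : ∫⁻ z, ENNReal.ofReal (min z 1) ∂ρ < ⊤)
    (hlog : ∫⁻ z, ENNReal.ofReal (max (Real.log z) 0) ∂ρ < ⊤) :
    ∫⁻ s in Set.Ioi (1 : ℝ), pF a b σ ρ s 0 < ⊤ := by
  have h1 := ccF_pos hb hσ one_pos
  set C := 1 / ccF b σ 1 with hC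
  have hCpos : 0 < C := by positivity
  have h0 : ∀ s, psi b σ s 0 = 0 := by simp [psi]
  have hle : ∫⁻ s in Set.Ioi (1 : ℝ), pF a b σ ρ s 0 ≤
      ∫⁻ s in Set.Ioi (1 : ℝ), (ENNReal.ofReal (a * C * Real.exp (-b * s)) +
        ∫⁻ z, ENNReal.ofReal (1 - Real.exp (-(z * (C * Real.exp (-b * s))))) ∂ρ) := by
    apply setLIntegral_mono' measurableSet_Ioi
    intro s hs
    have hk := kapF_le hb hσ (le_of_lt hs)
    rw [← hC] at hk
    unfold pF
    rw [h0]
    apply add_le_add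
    · apply ENNReal.ofReal_le_ofReal
      rw [zero_add, mul_assoc]
      gcongr
    · apply lintegral_mono_ae
      filter_upwards [hρ] with z hz
      apply ENNReal.ofReal_le_ofReal
      rw [mul_zero, Real.exp_zero]
      gcongr
  refine hle.trans_lt ?_
  rw [lintegral_add_left (by fun_prop), lint_exp hb _ _ (by positivity)]
  refine ENNReal.add_lt_top.2 ⟨ENNReal.ofReal_lt_top, ?_⟩
  have hm : Measurable (fun p : ℝ × ℝ => ENNReal.ofReal (1 - Real.exp (-(p.2 * (C * Real.exp (-b * p.1)))))) := by
    fun_prop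
  rw [lintegral_lintegral_swap hm.aemeasurable]
  calc ∫⁻ z, (∫⁻ s in Set.Ioi (1 : ℝ), ENNReal.ofReal (1 - Real.exp (-(z * (C * Real.exp (-b * s)))))) ∂ρ
      ≤ ∫⁻ z, (ENNReal.ofReal (1 / b) * ENNReal.ofReal (max (Real.log z) 0) +
        ENNReal.ofReal (C / b) * ENNReal.ofReal (min z 1)) ∂ρ := by
        apply lintegral_mono_ae
        filter_upwards [hρ] with z hz
        exact inner_bound hb hCpos hz
    _ < ⊤ := by
        rw [lintegral_add_left (by fun_prop), lintegral_const_mul _ (by fun_prop),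
          lintegral_const_mul _ (by fun_prop)]
        exact ENNReal.add_lt_top.2 ⟨ENNReal.mul_lt_top ENNReal.ofReal_lt_top hlog,
          ENNReal.mul_lt_top ENNReal.ofReal_lt_top hfin⟩

lemma kapF_tendsto {b σ : ℝ} (hb : 0 < b) (hσ : 0 < σ) :
    Tendsto (kapF b σ) atTop (nhds 0) := by
  have h1 := ccF_pos hb hσ one_pos
  have : Tendsto (fun s => 1 / ccF b σ 1 * Real.exp (-b * s)) atTop (nhds 0) := by
    have h2 : Tendsto (fun s : ℝ => -b * s) atTop atBot :=
      tendsto_id.const_mul_atTop_of_neg (by linarith)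
    simpa using (Real.tendsto_exp_atBot.comp h2).const_mul (1 / ccF b σ 1)
  refine squeeze_zero' ?_ ?_ this
  · filter_upwards [eventually_gt_atTop 0] with s hs using (kapF_pos hb hσ hs).le
  · filter_upwards [eventually_ge_atTop 1] with s hs using kapF_le hb hσ hs

lemma sfinite_of {ρ : Measure ℝ} (hρ : ∀ᵐ z ∂ρ, 0 < z)
    (hfin : ∫⁻ z, ENNReal.ofReal (min z 1) ∂ρ < ⊤) : SFinite ρ := by
  have hm : Measurable (fun z : ℝ => ENNReal.ofReal (min z 1)) := by fun_prop
  have hf : IsFiniteMeasure (ρ.withDensity (fun z : ℝ => ENNReal.ofReal (min z 1))) :=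
    isFiniteMeasure_withDensity hfin.ne
  have := withDensity_inv_same (μ := ρ) hm (by
    filter_upwards [hρ] with z hz
    simp [hz]) (by simp)
  rw [← this]
  infer_instance

lemma tv_le (μ π ρ : Measure ℝ) [IsProbabilityMeasure μ] [IsProbabilityMeasure π] [IsFiniteMeasure ρ]
    (h1 : ρ ≤ μ) (h2 : ρ ≤ π) : tvDist μ π ≤ 2 * (1 - ρ Set.univ) := by
  have key : ∀ (m₁ m₂ : Measure ℝ) [IsProbabilityMeasure m₁], ρ ≤ m₁ → ρ ≤ m₂ →
      (m₁ - m₂) Set.univ ≤ 1 - ρ Set.univ := by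
    intro m₁ m₂ _ h1 h2
    have : m₁ - m₂ ≤ m₁ - ρ := by
      apply Measure.sub_le_of_le_add
      calc m₁ = m₁ - ρ + ρ := (Measure.sub_add_cancel_of_le h1).symm
        _ ≤ m₁ - ρ + m₂ := by gcongr
    refine (this Set.univ).trans ?_
    rw [Measure.sub_apply MeasurableSet.univ h1, measure_univ]
  unfold tvDist
  rw [two_mul]
  exact add_le_add (key μ π h1 h2) (key π μ h2 h1)

lemma mono_lim (r : ℕ → Measure ℝ) [∀ n, IsFiniteMeasure (r n)] (hr : ∀ n, r n ≤ r (n + 1)) :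
    ∃ π : Measure ℝ, (∀ n, r n ≤ π) ∧ π Set.univ = ⨆ n, r n Set.univ := by
  have hps : ∀ n, ∀ s, MeasurableSet s →
      r n s = r 0 s + ∑ k ∈ Finset.range n, (r (k + 1) - r k) s := by
    intro n s hs
    induction n with
    | zero => simp
    | succ n ih =>
      rw [Finset.sum_range_succ, ← add_assoc, ← ih]
      conv_lhs => rw [← Measure.sub_add_cancel_of_le (hr n)]
      rw [Measure.add_apply, add_comm]
  refine ⟨r 0 + Measure.sum (fun k => r (k + 1) - r k), ?_, ?_⟩
  · intro n
    rw [Measure.le_iff]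
    intro s hs
    rw [hps n s hs, Measure.add_apply, Measure.sum_apply _ hs]
    gcongr
    exact ENNReal.sum_le_tsum _
  · rw [Measure.add_apply, Measure.sum_apply _ MeasurableSet.univ, ENNReal.tsum_eq_iSup_nat,
      ENNReal.add_iSup]
    congr 1
    ext n
    exact (hps n _ MeasurableSet.univ).symm

lemma smul_exp_le {m m' : Measure ℝ} {A : ℝ} (h : m ≤ ENNReal.ofReal (Real.exp A) • m') (B : ℝ) :
    ENNReal.ofReal (Real.exp B) • m ≤ ENNReal.ofReal (Real.exp (B + A)) • m' := by
  rw [Real.exp_add, ENNReal.ofReal_mul (Real.exp_pos _).le, mul_smul]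
  gcongr

lemma smul_exp_mono (m : Measure ℝ) {A B : ℝ} (h : A ≤ B) :
    ENNReal.ofReal (Real.exp A) • m ≤ ENNReal.ofReal (Real.exp B) • m := by
  gcongr

theorem jcir_ergodic (a b σ : ℝ) (ha : 0 < a) (hb : 0 < b) (hσ : 0 < σ)
    (ν : Measure ℝ) (hνsupp : ν (Set.Iic 0) = 0)
    (hν : ∫⁻ z in Set.Ioi (0 : ℝ), ENNReal.ofReal (min z 1) ∂ν < ⊤)
    (hνlog : ∫⁻ z in Set.Ioi (1 : ℝ), ENNReal.ofReal (Real.log z) ∂ν < ⊤)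
    (μ : ℝ → ℝ → Measure ℝ)
    (hμ : ∀ t x : ℝ, 0 ≤ t → 0 ≤ x → IsProbabilityMeasure (μ t x))
    (hμsupp : ∀ t x : ℝ, 0 ≤ t → 0 ≤ x → μ t x (Set.Iio 0) = 0)
    (hLap : ∀ t x : ℝ, 0 ≤ t → 0 ≤ x → ∀ u : ℝ, u ≤ 0 →
      ∫ y, Real.exp (u * y) ∂(μ t x) =
        (1 - σ ^ 2 * u / (2 * b) * (1 - Real.exp (-b * t))) ^ (-(2 * a / σ ^ 2)) *
          Real.exp (x * psi b σ t u) *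
          Real.exp (∫ s in Set.Ioc (0 : ℝ) t,
            ∫ z in Set.Ioi (0 : ℝ), (Real.exp (z * psi b σ s u) - 1) ∂ν)) :
    ∃ π : Measure ℝ, IsProbabilityMeasure π ∧
      ∀ x : ℝ, 0 ≤ x →
        Filter.Tendsto (fun t : ℝ => tvDist (μ t x) π) Filter.atTop (nhds 0) := by
  set ρ := ν.restrict (Set.Ioi 0) with hρdef
  have hρ : ∀ᵐ z ∂ρ, 0 < z := ae_restrict_mem measurableSet_Ioi
  have hsf : SFinite ρ := sfinite_of hρ hν
  have hlog : ∫⁻ z, ENNReal.ofReal (max (Real.log z) 0) ∂ρ < ⊤ := by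
    have hsub : Set.Ioi (0 : ℝ) ⊆ Set.Ioc 0 1 ∪ Set.Ioi 1 := by
      intro z hz
      rcases le_or_gt z 1 with h | h
      · exact Or.inl ⟨hz, h⟩
      · exact Or.inr h
    refine ((lintegral_mono_set hsub).trans (lintegral_union_le _ _ _)).trans_lt ?_
    have e1 : ∫⁻ z in Set.Ioc (0 : ℝ) 1, ENNReal.ofReal (max (Real.log z) 0) ∂ν = 0 := by
      rw [setLIntegral_congr_fun (g := fun _ => 0) measurableSet_Ioc]
      · simp
      · intro z hz
        simp [Real.log_nonpos hz.1.le hz.2]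
    have e2 : ∫⁻ z in Set.Ioi (1 : ℝ), ENNReal.ofReal (max (Real.log z) 0) ∂ν =
        ∫⁻ z in Set.Ioi (1 : ℝ), ENNReal.ofReal (Real.log z) ∂ν := by
      apply setLIntegral_congr_fun measurableSet_Ioi
      intro z hz
      simp only
      rw [max_eq_left (Real.log_nonneg (le_of_lt hz))]
    rw [e1, e2, zero_add]
    exact hνlog
  have hrate := rate_fin ha hb hσ ρ hρ hν hlog
  have hval : ∀ t x : ℝ, 0 ≤ t → 0 ≤ x → ∀ u : ℝ, u ≤ 0 → lapT (μ t x) u =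
      ENNReal.ofReal (Real.exp (x * psi b σ t u) *
      Real.exp (-(∫⁻ s in Set.Ioc 0 t, phiF a b σ ρ s u).toReal)) := by
    intro t x ht hx u hu
    have := hμ t x ht hx
    exact lap_val ha hb hσ ρ hρ hν (μ t x) (hμsupp t x ht hx) x ht hu (hLap t x ht hx u hu)
  have hval0 : ∀ t : ℝ, 0 ≤ t → ∀ u : ℝ, u ≤ 0 → lapT (μ t 0) u =
      ENNReal.ofReal (Real.exp (-(∫⁻ s in Set.Ioc 0 t, phiF a b σ ρ s u).toReal)) := by
    intro t ht u hu
    rw [hval t 0 ht le_rfl u hu]; simp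
  set G : ℝ → ℝ := fun T => (∫⁻ s in Set.Ioi T, pF a b σ ρ s 0).toReal with hG
  have hGfin : ∀ T, 1 ≤ T → ∫⁻ s in Set.Ioi T, pF a b σ ρ s 0 < ⊤ := fun T hT =>
    (lintegral_mono_set (Set.Ioi_subset_Ioi hT)).trans_lt hrate
  have hG0 : ∀ T, 0 ≤ G T := fun T => ENNReal.toReal_nonneg
  have htime : ∀ T t, 1 ≤ T → T ≤ t →
      μ T 0 ≤ ENNReal.ofReal (Real.exp (G T - G t)) • μ t 0 := by
    intro T t hT hTt
    have hT0 : 0 < T := by linarith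
    have ht0 : 0 < t := by linarith
    have := hμ T 0 hT0.le le_rfl
    have := hμ t 0 ht0.le le_rfl
    have hsp : ∫⁻ s in Set.Ioi T, pF a b σ ρ s 0 =
        (∫⁻ s in Set.Ioc T t, pF a b σ ρ s 0) + ∫⁻ s in Set.Ioi t, pF a b σ ρ s 0 := by
      rw [← Set.Ioc_union_Ioi_eq_Ioi hTt, lintegral_union measurableSet_Ioi]
      rw [Set.disjoint_left]
      intro y hy hy'
      exact absurd hy.2 (not_le.2 hy')
    have hf := hGfin T hT
    rw [hsp] at hf
    have hf' := ENNReal.add_lt_top.1 hf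
    have hd : G T - G t = (∫⁻ s in Set.Ioc T t, pF a b σ ρ s 0).toReal := by
      simp only [hG]
      rw [hsp, ENNReal.toReal_add hf'.1.ne hf'.2.ne]; ring
    rw [hd]
    exact step_time ha hb hσ ρ hρ hν _ _ (hμsupp T 0 hT0.le le_rfl) (hμsupp t 0 ht0.le le_rfl)
      hT0 hTt (hval0 T hT0.le) (hval0 t ht0.le) hf'.1
  have hspace : ∀ t x, 0 < t → 0 ≤ x →
      μ t 0 ≤ ENNReal.ofReal (Real.exp (x * kapF b σ t)) • μ t x := by
    intro t x ht hx
    have := hμ t 0 ht.le le_rfl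
    have := hμ t x ht.le hx
    apply step_x hb hσ _ _ (hμsupp t 0 ht.le le_rfl) (hμsupp t x ht.le hx) ht hx
    intro u hu
    rw [hval t x ht.le hx u hu, hval0 t ht.le u hu, ENNReal.ofReal_mul (Real.exp_pos _).le]
  set g : ℕ → ℝ := fun n => G ((n : ℝ) + 1) with hg
  have hn1 : ∀ n : ℕ, (1 : ℝ) ≤ (n : ℝ) + 1 := fun n => by
    have : (0 : ℝ) ≤ n := n.cast_nonneg
    linarith
  have hn0 : ∀ n : ℕ, (0 : ℝ) ≤ (n : ℝ) + 1 := fun n => by positivity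
  have hgt : Tendsto g atTop (nhds 0) := by
    set w := (volume : Measure ℝ).withDensity (fun s => pF a b σ ρ s 0) with hw
    have hwa : ∀ T, w (Set.Ioi T) = ∫⁻ s in Set.Ioi T, pF a b σ ρ s 0 := fun T =>
      withDensity_apply _ measurableSet_Ioi
    have hlim := tendsto_measure_iInter_atTop (μ := w) (s := fun n : ℕ => Set.Ioi ((n : ℝ) + 1))
      (fun n => measurableSet_Ioi.nullMeasurableSet)
      (fun n m hnm => Set.Ioi_subset_Ioi (by
        have : (n : ℝ) ≤ m := by exact_mod_cast hnm
        linarith))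
      ⟨0, by rw [hwa]; exact (hGfin _ (hn1 0)).ne⟩
    have hempty : ⋂ n : ℕ, Set.Ioi ((n : ℝ) + 1) = ∅ := by
      ext y
      simp only [Set.mem_iInter, Set.mem_Ioi, Set.mem_empty_iff_false, iff_false, not_forall, not_lt]
      obtain ⟨n, hn⟩ := exists_nat_ge y
      exact ⟨n, by linarith⟩
    rw [hempty, measure_empty] at hlim
    have := (ENNReal.tendsto_toReal ENNReal.zero_ne_top).comp hlim
    simpa [hg, hG, hwa, Function.comp_def] using this
  set r : ℕ → Measure ℝ := fun n => ENNReal.ofReal (Real.exp (-g n)) • μ ((n : ℝ) + 1) 0 with hr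
  have hrf : ∀ n, IsFiniteMeasure (r n) := by
    intro n
    have := hμ ((n : ℝ) + 1) 0 (hn0 n) le_rfl
    exact Measure.smul_finite _ ENNReal.ofReal_ne_top
  have hrmono : ∀ n, r n ≤ r (n + 1) := by
    intro n
    have h := htime ((n : ℝ) + 1) (((n + 1 : ℕ) : ℝ) + 1) (hn1 n) (by push_cast; linarith)
    have h2 := smul_exp_le h (-g n)
    have e : -g n + (G ((n : ℝ) + 1) - G (((n + 1 : ℕ) : ℝ) + 1)) = -g (n + 1) := by
      simp only [hg]; ring
    rw [e] at h2
    exact h2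
  have hru : ∀ n, r n Set.univ = ENNReal.ofReal (Real.exp (-g n)) := by
    intro n
    have := hμ ((n : ℝ) + 1) 0 (hn0 n) le_rfl
    simp [hr]
  obtain ⟨π, hπ1, hπ2⟩ := mono_lim r hrmono
  have hπu : π Set.univ = 1 := by
    rw [hπ2]
    apply iSup_eq_of_tendsto
    · apply monotone_nat_of_le_succ
      intro n
      exact hrmono n Set.univ
    · simp_rw [hru]
      have : Tendsto (fun n => Real.exp (-g n)) atTop (nhds (Real.exp (-0))) :=
        (Real.continuous_exp.tendsto _).comp hgt.neg
      have h2 := ENNReal.tendsto_ofReal this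
      simpa using h2
  have hπp : IsProbabilityMeasure π := ⟨hπu⟩
  refine ⟨π, hπp, ?_⟩
  intro x hx
  have hbound : ∀ᶠ t : ℝ in atTop, tvDist (μ t x) π ≤
      2 * (1 - ENNReal.ofReal (Real.exp (-(g ⌊t - 1⌋₊ + x * kapF b σ t)))) := by
    filter_upwards [eventually_ge_atTop (1 : ℝ)] with t ht
    set N := ⌊t - 1⌋₊ with hN
    have ht0 : 0 < t := by linarith
    have hNt : (N : ℝ) + 1 ≤ t := by
      have := Nat.floor_le (a := t - 1) (by linarith)
      linarith
    have hk := kapF_pos hb hσ ht0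
    have := hμ t x ht0.le hx
    have := hμ ((N : ℝ) + 1) 0 (hn0 N) le_rfl
    set η := ENNReal.ofReal (Real.exp (-(g N + x * kapF b σ t))) • μ ((N : ℝ) + 1) 0 with hη
    have hηf : IsFiniteMeasure η := Measure.smul_finite _ ENNReal.ofReal_ne_top
    have hηu : η Set.univ = ENNReal.ofReal (Real.exp (-(g N + x * kapF b σ t))) := by simp [hη]
    rw [← hηu]
    apply tv_le
    · have h1 := smul_exp_le (htime ((N : ℝ) + 1) t (hn1 N) hNt) (-(g N + x * kapF b σ t))
      have h2 := smul_exp_le (hspace t x ht0 hx) (-(g N + x * kapF b σ t) + (G ((N : ℝ) + 1) - G t))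
      refine h1.trans (h2.trans ?_)
      have h3 : -(g N + x * kapF b σ t) + (G ((N : ℝ) + 1) - G t) + x * kapF b σ t ≤ 0 := by
        have := hG0 t
        simp only [hg]; linarith
      refine (smul_exp_mono (μ t x) h3).trans ?_
      simp
    · refine le_trans ?_ (hπ1 N)
      apply smul_exp_mono
      have : 0 ≤ x * kapF b σ t := by positivity
      linarith
  have hlim : Tendsto (fun t : ℝ => 2 * (1 - ENNReal.ofReal (Real.exp (-(g ⌊t - 1⌋₊ + x * kapF b σ t)))))
      atTop (nhds 0) := by
    have hfl : Tendsto (fun t : ℝ => ⌊t - 1⌋₊) atTop atTop :=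
      tendsto_nat_floor_atTop.comp (tendsto_atTop_add_const_right _ (-1) tendsto_id)
    have h1 : Tendsto (fun t : ℝ => -(g ⌊t - 1⌋₊ + x * kapF b σ t)) atTop (nhds (-(0 + x * 0))) :=
      ((hgt.comp hfl).add ((kapF_tendsto hb hσ).const_mul x)).neg
    have h2 := ENNReal.tendsto_ofReal ((Real.continuous_exp.tendsto _).comp h1)
    have h3 := ENNReal.Tendsto.sub (tendsto_const_nhds (x := (1 : ℝ≥0∞))) h2 (Or.inl ENNReal.one_ne_top)
    have h4 := ENNReal.Tendsto.const_mul (a := 2) h3 (Or.inr (by simp))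
    simpa [Function.comp_def] using h4
  exact tendsto_of_tendsto_of_tendsto_of_le_of_le' tendsto_const_nhds hlim
    (Eventually.of_forall fun _ => zero_le) hbound
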